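/- Let K be a field with t ∈ K, t ∉ {0, 1, 2}. Consider the eight linear forms P₁ = x, P₂ = y, P₃ = x + y, P₄ = z, P₅ = x + 2y + z + t·v, P₆ = v, P₇ = y + z + v, P₈ = x + y + z + (t − 1)·v. The set of points of the line l₃ = {x = y = 0} ⊂ ℙ³(K) at which at least four of the eight forms vanish is exactly { (0:0:0:1), (0:0:−t:1), (0:0:1:0), (0:0:−1:1), (0:0:1−t:1) }, and these five points are pairwise distinct. Thus for t ∉ {0,1,2} the arrangement has exactly five fourfold points on the triple line l₃. -/

import Mathlib

/-- The eight linear forms `P₁ = x`, `P₂ = y`, `P₃ = x + y`, `P₄ = z`,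
`P₅ = x + 2y + z + t·v`, `P₆ = v`, `P₇ = y + z + v`, `P₈ = x + y + z + (t − 1)·v`
on `K⁴` defining the octic arrangement of the double octic family `X_t`. -/
def octicForms (K : Type*) [Field K] (t : K) : Fin 8 → ((Fin 4 → K) → K) :=
  ![fun w => w 0,
    fun w => w 1,
    fun w => w 0 + w 1,
    fun w => w 2,
    fun w => w 0 + 2 * w 1 + w 2 + t * w 3,
    fun w => w 3,
    fun w => w 1 + w 2 + w 3,
    fun w => w 0 + w 1 + w 2 + (t - 1) * w 3]

lemma octicVec_ne_zero (K : Type*) [Field K] (a b c : K) : (![a, b, c, 1] : Fin 4 → K) ≠ 0 := by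
  intro h
  have := congrFun h 3
  simp at this

lemma octicVec_ne_zero' (K : Type*) [Field K] : (![(0 : K), 0, 1, 0] : Fin 4 → K) ≠ 0 := by
  intro h
  have := congrFun h 2
  simp at this

/-- The line `x = y = 0` is parametrized by `(a : b) ↦ (0 : 0 : a : b)`: a point lies at parameter
`(a : b)` iff its first two coordinates vanish and its last two are proportional to `(a, b)`. -/
lemma mk_eq_mk_line_iff {K : Type*} [Field K] {w : Fin 4 → K} (hw : w ≠ 0) {a b : K}
    (hab : (![0, 0, a, b] : Fin 4 → K) ≠ 0) :
    Projectivization.mk K w hw = Projectivization.mk K ![0, 0, a, b] hab ↔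
      w 0 = 0 ∧ w 1 = 0 ∧ b * w 2 = a * w 3 := by
  rw [Projectivization.mk_eq_mk_iff']
  constructor
  · rintro ⟨c, rfl⟩
    simp
    ring
  · rintro ⟨hx, hy, h⟩
    by_cases hb : b = 0
    · have ha : a ≠ 0 := by
        rintro rfl
        apply hab
        ext i
        fin_cases i <;> simp [hb]
      have hv : w 3 = 0 := by simpa [hb, ha] using h
      refine ⟨w 2 / a, ?_⟩
      ext i
      fin_cases i <;> simp [hx, hy, hb, hv, ha]
    · refine ⟨w 3 / b, ?_⟩
      ext i
      fin_cases i <;> simp [hx, hy, hb]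
      field_simp
      linear_combination -h

/-- A point of the line `x = y = 0` already lies on three of the eight planes, so it lies on at
least four of them iff one of the remaining five forms vanishes there. -/
lemma four_le_ncard_octicForms_iff {K : Type*} [Field K] (t : K) {w : Fin 4 → K}
    (hx : w 0 = 0) (hy : w 1 = 0) :
    4 ≤ {i : Fin 8 | octicForms K t i w = 0}.ncard ↔
      w 2 = 0 ∨ w 2 + t * w 3 = 0 ∨ w 3 = 0 ∨ w 2 + w 3 = 0 ∨ w 2 + (t - 1) * w 3 = 0 := by
  have hcard : (({0, 1, 2} : Finset (Fin 8)) : Set (Fin 8)).ncard = 3 := by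
    rw [Set.ncard_coe_finset]
    rfl
  constructor
  · intro h
    obtain ⟨i, hi, hi'⟩ := Set.exists_mem_notMem_of_ncard_lt_ncard
      (s := (({0, 1, 2} : Finset (Fin 8)) : Set (Fin 8)))
      (t := {i | octicForms K t i w = 0}) (by omega)
    clear h
    fin_cases i <;> simp_all [octicForms]
  · intro h
    obtain ⟨i, hi, hi'⟩ :
        ∃ i : Fin 8, octicForms K t i w = 0 ∧ i ∉ ({0, 1, 2} : Finset (Fin 8)) := by
      rcases h with h | h | h | h | h
      · exact ⟨3, by simpa [octicForms] using h, by decide⟩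
      · exact ⟨4, by simpa [octicForms, hx, hy] using h, by decide⟩
      · exact ⟨5, by simpa [octicForms] using h, by decide⟩
      · exact ⟨6, by simpa [octicForms, hy] using h, by decide⟩
      · exact ⟨7, by simpa [octicForms, hx, hy] using h, by decide⟩
    have hlt : (({0, 1, 2} : Finset (Fin 8)) : Set (Fin 8)) ⊂ {i | octicForms K t i w = 0} := by
      refine Set.ssubset_iff_exists.2 ⟨?_, i, hi, by exact_mod_cast hi'⟩
      intro j hj
      fin_cases j <;> simp_all [octicForms]
    have := Set.ncard_lt_ncard hlt (Set.toFinite _)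
    omega

/-- For `t ∉ {0, 1, 2}`, the set of points of the line `l₃ = {x = y = 0} ⊂ ℙ³(K)` at
which at least four of the eight forms vanish is exactly
`{(0:0:0:1), (0:0:−t:1), (0:0:1:0), (0:0:−1:1), (0:0:1−t:1)}`, and these five points
are pairwise distinct: the arrangement has exactly five fourfold points on `l₃`. -/
theorem octic_five_fourfold_points_on_triple_line (K : Type*) [Field K] (t : K)
    (h0 : t ≠ 0) (h1 : t ≠ 1) (h2 : t ≠ 2) :
    {p : Projectivization K (Fin 4 → K) |
        p.rep 0 = 0 ∧ p.rep 1 = 0 ∧ 4 ≤ {i : Fin 8 | octicForms K t i p.rep = 0}.ncard} =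
      {Projectivization.mk K ![0, 0, 0, 1] (octicVec_ne_zero K 0 0 0),
       Projectivization.mk K ![0, 0, -t, 1] (octicVec_ne_zero K 0 0 (-t)),
       Projectivization.mk K ![0, 0, 1, 0] (octicVec_ne_zero' K),
       Projectivization.mk K ![0, 0, -1, 1] (octicVec_ne_zero K 0 0 (-1)),
       Projectivization.mk K ![0, 0, 1 - t, 1] (octicVec_ne_zero K 0 0 (1 - t))} ∧
    [Projectivization.mk K ![0, 0, 0, 1] (octicVec_ne_zero K 0 0 0),
     Projectivization.mk K ![0, 0, -t, 1] (octicVec_ne_zero K 0 0 (-t)),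
     Projectivization.mk K ![0, 0, 1, 0] (octicVec_ne_zero' K),
     Projectivization.mk K ![0, 0, -1, 1] (octicVec_ne_zero K 0 0 (-1)),
     Projectivization.mk K ![0, 0, 1 - t, 1] (octicVec_ne_zero K 0 0 (1 - t))].Pairwise (· ≠ ·) := by
  constructor
  · ext p
    have hp {a b : K} (hab : (![0, 0, a, b] : Fin 4 → K) ≠ 0) :
        p = Projectivization.mk K ![0, 0, a, b] hab ↔
          p.rep 0 = 0 ∧ p.rep 1 = 0 ∧ b * p.rep 2 = a * p.rep 3 := by
      rw [← mk_eq_mk_line_iff p.rep_nonzero hab, p.mk_rep]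
    simp only [Set.mem_ofPred_eq, Set.mem_insert_iff, Set.mem_singleton_iff, hp]
    by_cases hx : p.rep 0 = 0
    swap
    · simp [hx]
    by_cases hy : p.rep 1 = 0
    swap
    · simp [hy]
    rw [four_le_ncard_octicForms_iff t hx hy]
    simp only [hx, hy, true_and]
    grind
  · simp [mk_eq_mk_line_iff]
    grind
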